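/- Let C be a field of characteristic zero, α ∈ C, and f ∈ C(x) a nonzero rational function with derivative f′ (with respect to x). If ν_α(f) ≠ 0, then f′ ≠ 0 and ν_α(f′) = ν_α(f) − 1. -/

import Mathlib

open Polynomial

theorem X_sub_C_mul_derivative_X_sub_C_pow {R : Type*} [CommRing R] (a : R) (m : ℕ) :
    (X - C a) * derivative ((X - C a) ^ m) = C (m : R) * (X - C a) ^ m := by
  cases m with
  | zero => simp
  | succ k =>
    rw [derivative_X_sub_C_pow, Nat.add_sub_cancel]
    ring

/-- The Wronskian of two nonzero polynomials with distinct root multiplicities `m`, `n` at `a`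
has root multiplicity `m + n - 1` there. -/
theorem rootMultiplicity_derivative_mul_sub {F : Type*} [Field F] [CharZero F] (a : F)
    {p q : F[X]} (hp : p ≠ 0) (hq : q ≠ 0)
    (h : p.rootMultiplicity a ≠ q.rootMultiplicity a) :
    derivative p * q - p * derivative q ≠ 0 ∧
      (derivative p * q - p * derivative q).rootMultiplicity a + 1 =
        p.rootMultiplicity a + q.rootMultiplicity a := by
  obtain ⟨P, hP, hP'⟩ := exists_eq_pow_rootMultiplicity_mul_and_not_dvd p hp a
  obtain ⟨Q, hQ, hQ'⟩ := exists_eq_pow_rootMultiplicity_mul_and_not_dvd q hq a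
  generalize p.rootMultiplicity a = m at *
  generalize q.rootMultiplicity a = n at *
  rw [dvd_iff_isRoot, IsRoot.def] at hP' hQ'
  set R : F[X] := C ((m : F) - n) * P * Q
    + (X - C a) * (derivative P * Q - P * derivative Q) with hR
  have hRa : R.eval a ≠ 0 := by
    have : (m : F) - n ≠ 0 := sub_ne_zero.mpr (Nat.cast_injective.ne h)
    simp [hR, this, hP', hQ']
  have hR0 : R ≠ 0 := by
    rintro h0
    simp [h0] at hRa
  have hX : (X - C a) ≠ 0 := X_sub_C_ne_zero a
  have key : (derivative p * q - p * derivative q) * (X - C a) = (X - C a) ^ (m + n) * R := by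
    have h1 := X_sub_C_mul_derivative_X_sub_C_pow a m
    have h2 := X_sub_C_mul_derivative_X_sub_C_pow a n
    rw [hP, hQ, derivative_mul, derivative_mul, hR, C_sub, pow_add]
    linear_combination P * (X - C a) ^ n * Q * h1 - P * (X - C a) ^ m * Q * h2
  have hprod : (X - C a) ^ (m + n) * R ≠ 0 := mul_ne_zero (pow_ne_zero _ hX) hR0
  have hmul := congrArg (rootMultiplicity a) key
  rw [rootMultiplicity_mul (key ▸ hprod), rootMultiplicity_mul hprod,
    rootMultiplicity_X_sub_C_self, rootMultiplicity_X_sub_C_pow,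
    rootMultiplicity_eq_zero (p := R) hRa] at hmul
  exact ⟨left_ne_zero_of_mul (key ▸ hprod), hmul⟩

/-- rational-function base case of Lemma 2, finite place.
Let `C` be a field of characteristic zero, `α ∈ C`, and let `D` be the derivation of
`C(x)` extending the derivative of polynomials.  For nonzero `f ∈ C(x)`, the valuation
`ν_α(f)` is `rootMultiplicity α (num f) − rootMultiplicity α (denom f)`.
If `ν_α(f) ≠ 0` then `f′ ≠ 0` and `ν_α(f′) = ν_α(f) − 1`. -/
theorem stmt4 {C : Type*} [Field C] [CharZero C]
    (D : RatFunc C → RatFunc C)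
    (hD_add : ∀ a b : RatFunc C, D (a + b) = D a + D b)
    (hD_mul : ∀ a b : RatFunc C, D (a * b) = D a * b + a * D b)
    (hD_poly : ∀ p : Polynomial C,
      D (algebraMap (Polynomial C) (RatFunc C) p)
        = algebraMap (Polynomial C) (RatFunc C) (derivative p))
    (α : C) (f : RatFunc C) (hf : f ≠ 0)
    (hν : ((f.num.rootMultiplicity α : ℤ) - f.denom.rootMultiplicity α) ≠ 0) :
    D f ≠ 0 ∧
      (((D f).num.rootMultiplicity α : ℤ) - ((D f).denom.rootMultiplicity α)
        = ((f.num.rootMultiplicity α : ℤ) - f.denom.rootMultiplicity α) - 1) := by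
  have hp : f.num ≠ 0 := RatFunc.num_ne_zero hf
  have hq : f.denom ≠ 0 := f.denom_ne_zero
  obtain ⟨hw, hwm⟩ := rootMultiplicity_derivative_mul_sub α hp hq (by omega)
  set w := derivative f.num * f.denom - f.num * derivative f.denom with hw_def
  have hq' : algebraMap C[X] (RatFunc C) f.denom ≠ 0 := RatFunc.algebraMap_ne_zero hq
  have hfq : f * algebraMap C[X] (RatFunc C) f.denom = algebraMap C[X] (RatFunc C) f.num :=
    ((div_eq_iff hq').mp f.num_div_denom).symm
  have hD : D f * algebraMap C[X] (RatFunc C) (f.denom ^ 2) = algebraMap C[X] (RatFunc C) w := by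
    have h := hD_mul f (algebraMap C[X] (RatFunc C) f.denom)
    rw [hfq, hD_poly, hD_poly] at h
    simp only [hw_def, map_sub, map_mul, map_pow]
    linear_combination (-algebraMap C[X] (RatFunc C) f.denom) * h
      + algebraMap C[X] (RatFunc C) (derivative f.denom) * (-hfq)
  have hDf : D f ≠ 0 := by
    intro h0
    rw [h0, zero_mul] at hD
    exact RatFunc.algebraMap_ne_zero hw hD.symm
  have hd := (D f).denom_ne_zero
  have hpoly : (D f).num * f.denom ^ 2 = w * (D f).denom := by
    apply RatFunc.algebraMap_injective C
    have h := (div_eq_iff (RatFunc.algebraMap_ne_zero hd)).mp (D f).num_div_denom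
    rw [map_mul, map_mul, h, ← hD]
    ring
  have hmul := congrArg (rootMultiplicity α) hpoly
  rw [pow_two, rootMultiplicity_mul (mul_ne_zero (RatFunc.num_ne_zero hDf) (mul_ne_zero hq hq)),
    rootMultiplicity_mul (mul_ne_zero hq hq), rootMultiplicity_mul (mul_ne_zero hw hd)] at hmul
  exact ⟨hDf, by omega⟩
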